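/- arXiv:1809.10830 — 11 statements merged into one kernel-verified Lean document; each statement's English description precedes it below -/
import Mathlib

section
/- Let γ > 0 and define g(β) = (1−β)·ln(1+βγ) for β ∈ [0,1]. Then there exists a unique β* ∈ (0,1) satisfying γ(1−β*)/(1+β*γ) = ln(1+β*γ), and g attains its maximum over [0,1] at β* and at no other point of [0,1]. -/
theorem aux_lt (γ : ℝ) (hγ : 0 < γ) (a b : ℝ) (ha : 0 < a) (hab : a < b)
    (h1 : γ * (1 - a) / (1 + a * γ) = Real.log (1 + a * γ))
    (h2 : γ * (1 - b) / (1 + b * γ) = Real.log (1 + b * γ)) : False := by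
  have hb : 0 < b := ha.trans hab
  have pa : 0 < 1 + a * γ := by positivity
  have pb : 0 < 1 + b * γ := by positivity
  have hm : a * γ < b * γ := mul_lt_mul_of_pos_right hab hγ
  have hl : Real.log (1 + a * γ) < Real.log (1 + b * γ) :=
    Real.log_lt_log pa (by linarith)
  rw [← h1, ← h2, div_lt_div_iff₀ pa pb] at hl
  nlinarith [mul_lt_mul_of_pos_left hm hγ]

theorem aux_max (γ : ℝ) (hγ : 0 < γ) (x : ℝ) (hx : x ∈ Set.Icc (0:ℝ) 1)
    (h : ∀ y ∈ Set.Icc (0:ℝ) 1,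
      (1 - y) * Real.log (1 + y * γ) ≤ (1 - x) * Real.log (1 + x * γ)) :
    x ∈ Set.Ioo (0:ℝ) 1 ∧ γ * (1 - x) / (1 + x * γ) = Real.log (1 + x * γ) := by
  have hp : 0 < (1 - x) * Real.log (1 + x * γ) := by
    refine lt_of_lt_of_le ?_ (h (1/2) (by constructor <;> norm_num))
    have : 0 < Real.log (1 + 1/2 * γ) := Real.log_pos (by linarith)
    nlinarith
  have hI : x ∈ Set.Ioo (0:ℝ) 1 := by
    refine ⟨lt_of_le_of_ne hx.1 ?_, lt_of_le_of_ne hx.2 ?_⟩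
    · rintro rfl
      simp at hp
    · rintro rfl
      simp at hp
  refine ⟨hI, ?_⟩
  have px : 0 < 1 + x * γ := by
    have := mul_pos hI.1 hγ
    linarith
  have hd1 : HasDerivAt (fun y : ℝ => 1 - y) (-1) x := by
    simpa using (hasDerivAt_id x).const_sub 1
  have hd2 : HasDerivAt (fun y : ℝ => 1 + y * γ) γ x := by
    simpa using ((hasDerivAt_id x).mul_const γ).const_add 1
  have hd := hd1.fun_mul (hd2.log px.ne')
  have hmax : IsLocalMax (fun y : ℝ => (1 - y) * Real.log (1 + y * γ)) x := by
    filter_upwards [Icc_mem_nhds hI.1 hI.2] with y hy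
    exact h y hy
  have h0 := hmax.hasDerivAt_eq_zero hd
  have e : γ * (1 - x) / (1 + x * γ) = (1 - x) * (γ / (1 + x * γ)) := by ring
  rw [e]
  linarith

/-- For γ > 0 and g(β) = (1−β)·ln(1+βγ) on [0,1], there is a unique β* ∈ (0,1)
satisfying the stationarity equation γ(1−β*)/(1+β*γ) = ln(1+β*γ), and g attains
its maximum over [0,1] at β* and at no other point of [0,1]. -/
theorem stmt_0 (γ : ℝ) (hγ : 0 < γ) :
    ∃ β : ℝ, β ∈ Set.Ioo (0:ℝ) 1 ∧
      γ * (1 - β) / (1 + β * γ) = Real.log (1 + β * γ) ∧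
      (∀ β' ∈ Set.Ioo (0:ℝ) 1,
        γ * (1 - β') / (1 + β' * γ) = Real.log (1 + β' * γ) → β' = β) ∧
      (∀ x ∈ Set.Icc (0:ℝ) 1,
        (1 - x) * Real.log (1 + x * γ) ≤ (1 - β) * Real.log (1 + β * γ)) ∧
      (∀ x ∈ Set.Icc (0:ℝ) 1,
        (∀ y ∈ Set.Icc (0:ℝ) 1,
          (1 - y) * Real.log (1 + y * γ) ≤ (1 - x) * Real.log (1 + x * γ)) → x = β) := by
  have hc : ContinuousOn (fun y : ℝ => (1 - y) * Real.log (1 + y * γ)) (Set.Icc (0:ℝ) 1) := by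
    refine ContinuousOn.mul (by fun_prop) (ContinuousOn.log (by fun_prop) ?_)
    intro y hy
    have := mul_nonneg hy.1 hγ.le
    linarith
  obtain ⟨b, hb, hmax⟩ := isCompact_Icc.exists_isMaxOn ⟨(0:ℝ), by simp⟩ hc
  have hm : ∀ y ∈ Set.Icc (0:ℝ) 1,
      (1 - y) * Real.log (1 + y * γ) ≤ (1 - b) * Real.log (1 + b * γ) := fun y hy => hmax hy
  obtain ⟨hbI, hbs⟩ := aux_max γ hγ b hb hm
  have huniq : ∀ β' ∈ Set.Ioo (0:ℝ) 1,
      γ * (1 - β') / (1 + β' * γ) = Real.log (1 + β' * γ) → β' = b := by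
    intro c hcI hcs
    rcases lt_trichotomy c b with hlt | heq | hgt
    · exact (aux_lt γ hγ c b hcI.1 hlt hcs hbs).elim
    · exact heq
    · exact (aux_lt γ hγ b c hbI.1 hgt hbs hcs).elim
  refine ⟨b, hbI, hbs, huniq, hm, ?_⟩
  intro x hx hxm
  obtain ⟨h1, h2⟩ := aux_max γ hγ x hx hxm
  exact huniq x h1 h2
end

section
/- For each γ > 0, let β(γ) denote the unique β ∈ (0,1) satisfying γ(1−β)/(1+βγ) = ln(1+βγ). Then β(γ) → 0 and β(γ)·ln(γ) → 1 as γ → ∞. -/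
/-- If β(γ) denotes the unique β ∈ (0,1) satisfying γ(1−β)/(1+βγ) = ln(1+βγ),
then β(γ) → 0 and β(γ)·ln(γ) → 1 as γ → ∞. -/
theorem stmt_1 (β : ℝ → ℝ)
    (hβ : ∀ γ : ℝ, 0 < γ → β γ ∈ Set.Ioo (0:ℝ) 1 ∧
      γ * (1 - β γ) / (1 + β γ * γ) = Real.log (1 + β γ * γ)) :
    Filter.Tendsto β Filter.atTop (nhds 0) ∧
      Filter.Tendsto (fun γ => β γ * Real.log γ) Filter.atTop (nhds 1) := by
  have key : ∀ γ : ℝ, 0 < γ → 1 < 1 + β γ * γ ∧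
      γ + 1 = (1 + β γ * γ) * (1 + Real.log (1 + β γ * γ)) := by
    intro γ hγ
    obtain ⟨⟨h0, h1⟩, h⟩ := hβ γ hγ
    have hp : 0 < β γ * γ := mul_pos h0 hγ
    refine ⟨by linarith, ?_⟩
    rw [← h]
    field_simp
    ring
  have hx : Filter.Tendsto (fun γ => 1 + β γ * γ) Filter.atTop Filter.atTop := by
    refine Filter.tendsto_atTop_mono' _ ?_ Real.tendsto_sqrt_atTop
    filter_upwards [Filter.eventually_gt_atTop 0] with γ hγ
    obtain ⟨h1, h2⟩ := key γ hγ
    have h3 := Real.log_le_sub_one_of_pos (by linarith : 0 < 1 + β γ * γ)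
    apply Real.sqrt_le_iff.2
    refine ⟨by linarith, ?_⟩
    nlinarith
  have hu : Filter.Tendsto (fun γ => 1 + Real.log (1 + β γ * γ)) Filter.atTop Filter.atTop :=
    Filter.tendsto_atTop_add_const_left _ _ (Real.tendsto_log_atTop.comp hx)
  have hxi := tendsto_inv_atTop_zero.comp hx
  have hui := tendsto_inv_atTop_zero.comp hu
  have hlu := (Real.isLittleO_log_id_atTop.tendsto_div_nhds_zero).comp hu
  have upper : ∀ γ : ℝ, 0 < γ → β γ ≤ (1 + Real.log (1 + β γ * γ))⁻¹ := by
    intro γ hγ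
    obtain ⟨h1, h2⟩ := key γ hγ
    have hL := Real.log_pos h1
    obtain ⟨⟨h0, h3⟩, -⟩ := hβ γ hγ
    rw [← one_div, le_div_iff₀ (by linarith)]
    have h4 : β γ * γ * (1 + Real.log (1 + β γ * γ)) ≤ γ := by nlinarith
    by_contra hc
    push Not at hc
    nlinarith
  constructor
  · refine tendsto_of_tendsto_of_tendsto_of_le_of_le' tendsto_const_nhds hui ?_ ?_
    · filter_upwards [Filter.eventually_gt_atTop 0] with γ hγ
      exact (hβ γ hγ).1.1.le
    · filter_upwards [Filter.eventually_gt_atTop 0] with γ hγ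
      exact upper γ hγ
  · have hlow := (hxi.const_sub 1).mul (hui.const_sub 1)
    have hup := (hui.const_sub 1).add hlu
    simp only [sub_zero, mul_one, add_zero, Function.comp_def, id] at hlow hup
    refine tendsto_of_tendsto_of_tendsto_of_le_of_le' hlow hup ?_ ?_
    · filter_upwards [Filter.eventually_gt_atTop 0, hu.eventually_ge_atTop 2] with γ hγ hu2
      obtain ⟨h1, h2⟩ := key γ hγ
      obtain ⟨⟨h0, h3⟩, -⟩ := hβ γ hγ
      have hlg : Real.log (1 + β γ * γ) ≤ Real.log γ :=
        Real.log_le_log (by linarith) (by nlinarith)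
      have hxdef : β γ * γ = (1 + β γ * γ) - 1 := by ring
      generalize Real.log (1 + β γ * γ) = L at *
      generalize 1 + β γ * γ = x at *
      have hb : (1 - x⁻¹) ≤ β γ * (1 + L) := by
        have e : β γ * (1 + L) * x = x - 1 + β γ := by
          rw [mul_assoc, mul_comm (1 + L) x, ← h2]; linarith
        have e2 : (1 - x⁻¹) * x = x - 1 := by field_simp
        by_contra hc
        push Not at hc
        nlinarith
      calc (1 - x⁻¹) * (1 - (1 + L)⁻¹) ≤ β γ * (1 + L) * (1 - (1 + L)⁻¹) := by
            apply mul_le_mul_of_nonneg_right hb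
            have := inv_le_one_of_one_le₀ (by linarith : 1 ≤ 1 + L)
            linarith
        _ = β γ * L := by
            have : 1 + L ≠ 0 := by linarith
            field_simp
            ring
        _ ≤ _ := mul_le_mul_of_nonneg_left hlg h0.le
    · filter_upwards [Filter.eventually_gt_atTop 1] with γ hγ1
      have hγ : 0 < γ := by linarith
      obtain ⟨h1, h2⟩ := key γ hγ
      have hL := Real.log_pos h1
      have hup := upper γ hγ
      have hlg : Real.log γ ≤ Real.log (1 + β γ * γ) +
          Real.log (1 + Real.log (1 + β γ * γ)) := by
        rw [← Real.log_mul (by linarith) (by linarith), ← h2]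
        exact Real.log_le_log hγ (by linarith)
      generalize Real.log (1 + β γ * γ) = L at *
      have hne : 1 + L ≠ 0 := by linarith
      calc β γ * Real.log γ ≤ (1 + L)⁻¹ * Real.log γ :=
            mul_le_mul_of_nonneg_right hup (Real.log_pos hγ1).le
        _ ≤ (1 + L)⁻¹ * (L + Real.log (1 + L)) :=
            mul_le_mul_of_nonneg_left hlg (by positivity)
        _ = _ := by
            field_simp
            ring
end

section
/- Let K ≥ 1 and M ≥ 2 be integers and let σ² ∈ ℝ^K satisfy 0 ≤ σ²_k < (M−1)/M for all k. Define v ∈ ℝ^K by v_k = 1/((M−1) − M·σ²_k). Then the mixing power matrix 𝐌(σ²) is invertible and 𝐌(σ²)⁻¹ = diag(v) − (1/(1+Σ_k v_k))·v·vᵀ. -/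
/-- Sherman–Morrison inverse of the mixing power matrix: with diagonal entries
M(1−σ²ₖ) and off-diagonal entries 1, and vₖ = 1/((M−1) − Mσ²ₖ), the matrix is
invertible with inverse diag(v) − (1/(1+Σ v))·v·vᵀ. -/
theorem stmt_2 (K M : ℕ) (hK : 1 ≤ K) (hM : 2 ≤ M)
    (σ : Fin K → ℝ) (hσ : ∀ k, 0 ≤ σ k ∧ σ k < ((M:ℝ) - 1) / M)
    (Mmat : Matrix (Fin K) (Fin K) ℝ)
    (hMmat : ∀ i j, Mmat i j = if i = j then (M:ℝ) * (1 - σ i) else 1)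
    (v : Fin K → ℝ) (hv : ∀ k, v k = 1 / (((M:ℝ) - 1) - M * σ k)) :
    IsUnit Mmat.det ∧
      Mmat⁻¹ = Matrix.diagonal v - (1 / (1 + ∑ k, v k)) • Matrix.vecMulVec v v := by
  have hM0 : (0:ℝ) < M := by
    have : 0 < M := by omega
    exact_mod_cast this
  have hd : ∀ k, 0 < ((M:ℝ) - 1) - M * σ k := by
    intro k
    have h := (lt_div_iff₀ hM0).1 (hσ k).2
    linarith
  have hvpos : ∀ k, 0 < v k := by
    intro k
    rw [hv k]
    exact one_div_pos.2 (hd k)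
  have hdv : ∀ k, (((M:ℝ) - 1) - M * σ k) * v k = 1 := by
    intro k
    rw [hv k]
    exact mul_one_div_cancel (hd k).ne'
  have hS : (1 + ∑ k, v k) ≠ 0 := by
    have : 0 ≤ ∑ k, v k := Finset.sum_nonneg fun k _ => (hvpos k).le
    linarith
  have hentry : ∀ i j, Mmat i j = 1 + if i = j then ((M:ℝ) - 1) - M * σ i else 0 := by
    intro i j
    rw [hMmat]
    split_ifs <;> ring
  have hrow : ∀ i, ∑ k, Mmat i k * v k = 1 + ∑ k, v k := by
    intro i
    simp only [hentry, add_mul, one_mul, ite_mul, zero_mul, Finset.sum_add_distrib,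
      Finset.sum_ite_eq, Finset.mem_univ, if_true]
    rw [hdv i, add_comm]
  have hmul : Mmat * (Matrix.diagonal v - (1 / (1 + ∑ k, v k)) • Matrix.vecMulVec v v) = 1 := by
    rw [Matrix.mul_sub, Matrix.mul_smul]
    ext i j
    have h2 : (Mmat * Matrix.vecMulVec v v) i j = (1 + ∑ k, v k) * v j := by
      rw [← hrow i, Matrix.mul_apply, Finset.sum_mul]
      refine Finset.sum_congr rfl fun k _ => ?_
      rw [Matrix.vecMulVec_apply, mul_assoc]
    rw [Matrix.sub_apply, Matrix.smul_apply, h2, Matrix.mul_diagonal, smul_eq_mul,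
      ← mul_assoc, one_div_mul_cancel hS, hentry, Matrix.one_apply]
    split_ifs with h
    · subst h
      linarith [hdv i]
    · ring
  exact ⟨Matrix.isUnit_det_of_right_inverse hmul, Matrix.inv_eq_right_inv hmul⟩
end

section
/- Let K ≥ 1, δ > 0, c₀ > 0, d₀ > 0, let v ∈ ℝ^K have all entries positive, and let d ∈ ℝ^K have all entries positive. Define b ∈ ℝ^K by b_k = c₀·d₀^δ·d_k^{−δ}, and define ξ ∈ ℝ^K by ξ = diag(v)·b⁻² − (vᵀb⁻²/(1+Σ_i v_i))·v, where b⁻² is entrywise. If ξ_k = 0 for some index k, then d_k = ( vᵀd^{2δ} / (1 + Σ_i v_i) )^{1/(2δ)}, where d^{2δ} denotes the entrywise vector (d_i^{2δ}). -/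
/-- Fairness radius (Theorem 2): under the long-term fading model
b_k = c₀·d₀^δ·d_k^{−δ}, if the (unnormalized) optimal energy allocation weight
ξ_k = v_k·b_k⁻² − (vᵀb⁻²/(1+Σv))·v_k vanishes, then the distance d_k equals
(vᵀd^{2δ}/(1+Σv))^{1/(2δ)}. -/
theorem stmt_4 (K : ℕ) (hK : 1 ≤ K) (δ c₀ d₀ : ℝ) (hδ : 0 < δ) (hc₀ : 0 < c₀)
    (hd₀ : 0 < d₀)
    (v d : Fin K → ℝ) (hv : ∀ k, 0 < v k) (hd : ∀ k, 0 < d k)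
    (b : Fin K → ℝ) (hb : ∀ k, b k = c₀ * d₀ ^ δ * (d k) ^ (-δ))
    (ξ : Fin K → ℝ)
    (hξ : ∀ k, ξ k = v k * ((b k) ^ 2)⁻¹ -
      (∑ i, v i * ((b i) ^ 2)⁻¹) / (1 + ∑ i, v i) * v k)
    (k : Fin K) (hk : ξ k = 0) :
    d k = ((∑ i, v i * (d i) ^ (2 * δ)) / (1 + ∑ i, v i)) ^ (1 / (2 * δ)) := by
  have hA : 0 < c₀ * d₀ ^ δ := mul_pos hc₀ (Real.rpow_pos_of_pos hd₀ δ)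
  have hb2 : ∀ i, ((b i) ^ 2)⁻¹ = ((c₀ * d₀ ^ δ) ^ 2)⁻¹ * (d i) ^ (2 * δ) := by
    intro i
    have h2 : (d i) ^ (2 * δ) = ((d i) ^ δ) ^ 2 := by
      rw [mul_comm, Real.rpow_mul (hd i).le, Real.rpow_two]
    rw [hb, Real.rpow_neg (hd i).le, h2, mul_pow, mul_inv, inv_pow, inv_inv]
  have hsum : ∑ i, v i * ((b i) ^ 2)⁻¹
      = ((c₀ * d₀ ^ δ) ^ 2)⁻¹ * ∑ i, v i * (d i) ^ (2 * δ) := by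
    rw [Finset.mul_sum]
    refine Finset.sum_congr rfl fun i _ => ?_
    rw [hb2]; ring
  have hC : ((c₀ * d₀ ^ δ) ^ 2)⁻¹ ≠ 0 := by positivity
  have h := hξ k
  rw [hk, hsum, hb2] at h
  have key : (∑ i, v i * (d i) ^ (2 * δ)) / (1 + ∑ i, v i) = (d k) ^ (2 * δ) := by
    apply mul_left_cancel₀ (mul_ne_zero hC (hv k).ne')
    linear_combination h
  rw [key, ← Real.rpow_mul (hd k).le, mul_one_div_cancel (by positivity), Real.rpow_one]
end

section
/- Let K ≥ 1 and M ≥ 2 be integers, let ξ ∈ ℝ^K satisfy ξ_k ≥ 0 for all k and Σ_k ξ_k = 1, let n ∈ ℝ^K satisfy n_k ≥ 1/ln(2) for all k, and let σ² ∈ ℝ^K satisfy 0 ≤ σ²_k ≤ 2^{−n_k/(M−1)} for all k. Then for every k: M·ξ_k·(1−σ²_k) + Σ_{i≠k} ξ_i ≥ σ²_k; that is, (𝐌(σ²)ξ)_k ≥ σ²_k componentwise. -/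
/-- Lemma 1 (pareto optimality): if each device feeds back at least 1/ln 2 bits
and σ²ₖ ≤ 2^{−nₖ/(M−1)}, then M·ξₖ(1−σ²ₖ) + Σ_{i≠k} ξᵢ ≥ σ²ₖ for every k,
i.e. (𝐌(σ²)ξ)ₖ ≥ σ²ₖ componentwise. -/
theorem stmt_7 (K M : ℕ) (hK : 1 ≤ K) (hM : 2 ≤ M)
    (ξ : Fin K → ℝ) (hξ : ∀ k, 0 ≤ ξ k) (hξ1 : ∑ k, ξ k = 1)
    (n : Fin K → ℝ) (hn : ∀ k, 1 / Real.log 2 ≤ n k)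
    (σ : Fin K → ℝ) (hσ : ∀ k, 0 ≤ σ k ∧ σ k ≤ (2:ℝ) ^ (-(n k) / ((M:ℝ) - 1)))
    (Mmat : Matrix (Fin K) (Fin K) ℝ)
    (hMmat : ∀ i j, Mmat i j = if i = j then (M:ℝ) * (1 - σ i) else 1) :
    ∀ k, ((M:ℝ) * ξ k * (1 - σ k) + ∑ i ∈ Finset.univ.erase k, ξ i ≥ σ k) ∧
      σ k ≤ Mmat.mulVec ξ k := by
  intro k
  have hM' : (2:ℝ) ≤ M := by exact_mod_cast hM
  have hm : (0:ℝ) < (M:ℝ) - 1 := by linarith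
  have hl : 0 < Real.log 2 := Real.log_pos (by norm_num)
  obtain ⟨h0, h1⟩ := hσ k
  have hnk : 1 ≤ n k * Real.log 2 := (div_le_iff₀ hl).1 (hn k)
  have h2 : σ k ≤ Real.exp (-(1 / ((M:ℝ) - 1))) := by
    refine h1.trans ?_
    rw [Real.rpow_def_of_pos (by norm_num : (0:ℝ) < 2)]
    apply Real.exp_le_exp.2
    have h3 : 1 / ((M:ℝ) - 1) ≤ (n k * Real.log 2) / ((M:ℝ) - 1) := by gcongr
    have h4 : Real.log 2 * (-(n k) / ((M:ℝ) - 1)) = -((n k * Real.log 2) / ((M:ℝ) - 1)) := by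
      ring
    rw [h4]
    linarith
  have h5 : σ k * ((M:ℝ) / ((M:ℝ) - 1)) ≤ 1 := by
    have h6 : (M:ℝ) / ((M:ℝ) - 1) ≤ Real.exp (1 / ((M:ℝ) - 1)) := by
      have h7 := Real.add_one_le_exp (1 / ((M:ℝ) - 1))
      have h8 : (M:ℝ) / ((M:ℝ) - 1) = 1 / ((M:ℝ) - 1) + 1 := by
        field_simp
        ring
      linarith
    calc σ k * ((M:ℝ) / ((M:ℝ) - 1))
        ≤ Real.exp (-(1 / ((M:ℝ) - 1))) * Real.exp (1 / ((M:ℝ) - 1)) := by gcongr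
      _ = 1 := by rw [← Real.exp_add]; simp
  have h9 : σ k * M ≤ (M:ℝ) - 1 := by
    rw [← mul_div_assoc, div_le_one hm] at h5
    exact h5
  have h10 : σ k ≤ 1 := by nlinarith
  have hs : ξ k + ∑ i ∈ Finset.univ.erase k, ξ i = 1 := by
    rw [Finset.add_sum_erase _ _ (Finset.mem_univ k), hξ1]
  have hmain : (M:ℝ) * ξ k * (1 - σ k) + ∑ i ∈ Finset.univ.erase k, ξ i ≥ σ k := by
    have := mul_nonneg (hξ k) (sub_nonneg.2 h9)
    nlinarith
  refine ⟨hmain, ?_⟩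
  have he : Mmat.mulVec ξ k
      = (M:ℝ) * ξ k * (1 - σ k) + ∑ i ∈ Finset.univ.erase k, ξ i := by
    simp only [Matrix.mulVec, dotProduct]
    rw [← Finset.add_sum_erase _ _ (Finset.mem_univ k), hMmat, if_pos rfl]
    congr 1
    · ring
    · apply Finset.sum_congr rfl
      intro i hi
      rw [hMmat, if_neg (Finset.ne_of_mem_erase hi).symm, one_mul]
  rw [he]
  exact hmain
end

section
/- Let A ≥ B > 0 and c > 0 be reals with c·B < (1+A−B)^{c+1}. Then the map g(x) = 1 + A − B·x^{−c} maps the interval [1+A−B, 1+A] into itself and has a unique fixed point x* in [1+A−B, 1+A], i.e., a unique x* in that interval with x* = 1 + A − B·(x*)^{−c}. -/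
/-- The map g(x) = 1 + A − B·x^{−c} maps [1+A−B, 1+A] into itself and has a
unique fixed point there, provided A ≥ B > 0, c > 0 and c·B < (1+A−B)^{c+1}. -/
theorem stmt_8 (A B c : ℝ) (hAB : B ≤ A) (hB : 0 < B) (hc : 0 < c)
    (hcontr : c * B < (1 + A - B) ^ (c + 1)) :
    Set.MapsTo (fun x : ℝ => 1 + A - B * x ^ (-c)) (Set.Icc (1 + A - B) (1 + A))
        (Set.Icc (1 + A - B) (1 + A)) ∧
      ∃! x : ℝ, x ∈ Set.Icc (1 + A - B) (1 + A) ∧ x = 1 + A - B * x ^ (-c) := by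
  have hL : 1 ≤ 1 + A - B := by linarith
  have key : ∀ x ∈ Set.Icc (1 + A - B) (1 + A), 0 < x ^ (-c) ∧ x ^ (-c) ≤ 1 := by
    intro x hx
    have h1 : 1 ≤ x := hL.trans hx.1
    exact ⟨Real.rpow_pos_of_pos (by linarith) _,
      Real.rpow_le_one_of_one_le_of_nonpos h1 (by linarith)⟩
  have hcont : ContinuousOn (fun x : ℝ => x + B * x ^ (-c)) (Set.Icc (1 + A - B) (1 + A)) := by
    intro x hx
    have h1 : 1 ≤ x := hL.trans hx.1
    have h2 : ContinuousAt (fun x : ℝ => x ^ (-c)) x :=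
      Real.continuousAt_rpow_const _ _ (Or.inl (by linarith))
    exact (continuousAt_id.add (continuousAt_const.mul h2)).continuousWithinAt
  have hmono : StrictMonoOn (fun x : ℝ => x + B * x ^ (-c))
      (Set.Icc (1 + A - B) (1 + A)) := by
    apply strictMonoOn_of_deriv_pos (convex_Icc _ _) hcont
    intro x hx
    rw [interior_Icc] at hx
    have hx0 : 0 < x := by linarith [hx.1]
    have hd : HasDerivAt (fun x : ℝ => x + B * x ^ (-c)) (1 + B * (-c * x ^ (-c - 1))) x :=
      (hasDerivAt_id x).add ((Real.hasDerivAt_rpow_const (Or.inl hx0.ne')).const_mul B)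
    rw [hd.deriv]
    have h3 : (1 + A - B) ^ (c + 1) ≤ x ^ (c + 1) :=
      Real.rpow_le_rpow (by linarith) hx.1.le (by linarith)
    have h4 : x ^ (-c - 1) * x ^ (c + 1) = 1 := by
      rw [← Real.rpow_add hx0]; ring_nf; exact Real.rpow_zero x
    have h5 : 0 < x ^ (-c - 1) := Real.rpow_pos_of_pos hx0 _
    nlinarith [mul_lt_mul_of_pos_left (hcontr.trans_le h3) h5]
  refine ⟨?_, ?_⟩
  · intro x hx
    obtain ⟨h1, h2⟩ := key x hx
    constructor
    · show 1 + A - B ≤ 1 + A - B * x ^ (-c)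
      nlinarith
    · show 1 + A - B * x ^ (-c) ≤ 1 + A
      nlinarith
  · have hle : 1 + A - B ≤ 1 + A := by linarith
    have hl := key _ (Set.left_mem_Icc.2 hle)
    have hr := key _ (Set.right_mem_Icc.2 hle)
    have hmem : 1 + A ∈ Set.Icc ((1 + A - B) + B * (1 + A - B) ^ (-c))
        ((1 + A) + B * (1 + A) ^ (-c)) := by
      constructor
      · nlinarith [hl.2]
      · nlinarith [hr.1]
    obtain ⟨x, hx, hxe⟩ := intermediate_value_Icc hle hcont hmem
    have hxe' : x + B * x ^ (-c) = 1 + A := hxe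
    refine ⟨x, ⟨hx, by linarith⟩, ?_⟩
    rintro y ⟨hy, hye⟩
    apply hmono.injOn hy hx
    show y + B * y ^ (-c) = x + B * x ^ (-c)
    linarith
end

section
/- Let D > 0, c > 0, A > 0, L > 0 be reals and let w : (0,1) → ℝ be differentiable with w(α) > 0 and 1 + A − L·2^{−(α/(1−α))·c·w(α)} > 0 for all α, satisfying w(α) = (1−α)·D·log₂( 1 + A − L·2^{−(α/(1−α))·c·w(α)} ) for all α ∈ (0,1). If w′(α₀) = 0 for some α₀ ∈ (0,1), then 2^{−c·α₀·w(α₀)/(1−α₀)} = (1+A) / ( L·(D·c + 1) ). -/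
/-- First-order stationarity condition of Theorem 5: if the WIT data rate
w(α) = (1−α)·D·log₂(1 + A − L·2^{−(α/(1−α))·c·w(α)}) has a critical point
α₀ ∈ (0,1), then 2^{−c·α₀·w(α₀)/(1−α₀)} = (1+A)/(L(Dc+1)). -/
theorem stmt_10 (D c A L : ℝ) (hD : 0 < D) (hc : 0 < c) (hA : 0 < A) (hL : 0 < L)
    (w : ℝ → ℝ)
    (hdiff : ∀ α ∈ Set.Ioo (0:ℝ) 1, DifferentiableAt ℝ w α)
    (hpos : ∀ α ∈ Set.Ioo (0:ℝ) 1, 0 < w α)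
    (harg : ∀ α ∈ Set.Ioo (0:ℝ) 1,
      0 < 1 + A - L * (2:ℝ) ^ (-(α / (1 - α)) * c * w α))
    (heq : ∀ α ∈ Set.Ioo (0:ℝ) 1,
      w α = (1 - α) * D * Real.logb 2 (1 + A - L * (2:ℝ) ^ (-(α / (1 - α)) * c * w α)))
    (α₀ : ℝ) (hα₀ : α₀ ∈ Set.Ioo (0:ℝ) 1) (hderiv : deriv w α₀ = 0) :
    (2:ℝ) ^ (-(c * α₀ * w α₀ / (1 - α₀))) = (1 + A) / (L * (D * c + 1)) := by
  have h1 : 0 < 1 - α₀ := by linarith [hα₀.2]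
  have hw0 := hpos α₀ hα₀
  have hX := harg α₀ hα₀
  have he := heq α₀ hα₀
  have hw : HasDerivAt w 0 α₀ := hderiv ▸ (hdiff α₀ hα₀).hasDerivAt
  have hs : HasDerivAt (fun α : ℝ => 1 - α) (-1) α₀ := by
    simpa using (hasDerivAt_id α₀).const_sub 1
  have hu : HasDerivAt (fun α : ℝ => -(α / (1 - α)) * c * w α)
      (-(c * w α₀ / (1 - α₀) ^ 2)) α₀ := by
    have h := ((((hasDerivAt_id α₀).div hs h1.ne').neg).mul_const c).mul hw
    refine h.congr_deriv ?_
    simp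
    field_simp
  have hE := hu.const_rpow (a := 2) (by norm_num)
  have hY := ((hE.const_mul L).const_sub (1 + A)).log hX.ne'
  have hR := (hs.mul_const D).mul (hY.div_const (Real.log 2))
  have hev : w =ᶠ[nhds α₀] (fun α => (1 - α) * D *
      (Real.log (1 + A - L * (2:ℝ) ^ (-(α / (1 - α)) * c * w α)) / Real.log 2)) := by
    filter_upwards [isOpen_Ioo.mem_nhds hα₀] with α hα
    exact heq α hα
  have key := (hw.congr_of_eventuallyEq hev.symm).unique hR
  have hexp : -(c * α₀ * w α₀ / (1 - α₀)) = -(α₀ / (1 - α₀)) * c * w α₀ := by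
    field_simp
  rw [hexp]
  simp only [Real.logb] at he
  generalize (2:ℝ) ^ (-(α₀ / (1 - α₀)) * c * w α₀) = E at *
  have hl2 : Real.log 2 ≠ 0 := (Real.log_pos (by norm_num)).ne'
  generalize Real.log (1 + A - L * E) = G at *
  generalize Real.log 2 = l at *
  have hX' := hX.ne'
  have hG : D * (G / l) = w α₀ / (1 - α₀) := by
    rw [eq_div_iff h1.ne']; linarith
  have key2 : 0 = -(w α₀ / (1 - α₀)) + D * L * E * c * w α₀ / ((1 - α₀) * (1 + A - L * E)) := by
    rw [← hG]
    rw [key]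
    field_simp
    try ring
  have key3 : 1 + A - L * E = D * c * (L * E) := by
    generalize hXd : 1 + A - L * E = X at *
    field_simp at key2
    have h0 : w α₀ * (-X + D * L * E * c) = 0 := by rw [← key2]; ring
    rcases mul_eq_zero.mp h0 with h | h
    · exact absurd h hw0.ne'
    · linarith
  rw [eq_div_iff (by positivity)]
  linarith
end

section
/- Let A > B > 0 and c > 0 be reals. Then the function F(α) = (1−α)·ln( 1 + A − B·2^{−cα} ) is positive on [0,1) and log-concave on [0,1); that is, ln(F(α)) is a concave function of α on [0,1). -/
theorem log_concave_aux {s : Set ℝ} {f : ℝ → ℝ} (hf : ConcaveOn ℝ s f)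
    (hpos : ∀ x ∈ s, 0 < f x) : ConcaveOn ℝ s (fun x => Real.log (f x)) := by
  refine ⟨hf.1, ?_⟩
  intro x hx y hy a b ha hb hab
  have h1 := strictConcaveOn_log_Ioi.concaveOn.2 (Set.mem_Ioi.2 (hpos x hx))
    (Set.mem_Ioi.2 (hpos y hy)) ha hb hab
  have h2 := hf.2 hx hy ha hb hab
  have h3 : a • f x + b • f y ∈ Set.Ioi (0:ℝ) :=
    (convex_Ioi (0:ℝ)) (Set.mem_Ioi.2 (hpos x hx)) (Set.mem_Ioi.2 (hpos y hy)) ha hb hab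
  exact h1.trans (Real.log_le_log h3 h2)

/-- Lemma 4: F(α) = (1−α)·ln(1 + A − B·2^{−cα}) is positive and log-concave on
[0,1), for A > B > 0 and c > 0. -/
theorem stmt_11 (A B c : ℝ) (hB : 0 < B) (hAB : B < A) (hc : 0 < c) :
    (∀ α ∈ Set.Ico (0:ℝ) 1,
      0 < (1 - α) * Real.log (1 + A - B * (2:ℝ) ^ (-(c * α)))) ∧
    ConcaveOn ℝ (Set.Ico (0:ℝ) 1)
      (fun α => Real.log ((1 - α) * Real.log (1 + A - B * (2:ℝ) ^ (-(c * α))))) := by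
  have hg1 : ∀ α ∈ Set.Ico (0:ℝ) 1, 1 < 1 + A - B * (2:ℝ) ^ (-(c * α)) := by
    intro α hα
    have h : (2:ℝ) ^ (-(c * α)) ≤ 1 :=
      Real.rpow_le_one_of_one_le_of_nonpos (by norm_num)
        (neg_nonpos.2 (mul_nonneg hc.le hα.1))
    nlinarith
  have hl : ∀ α ∈ Set.Ico (0:ℝ) 1, 0 < Real.log (1 + A - B * (2:ℝ) ^ (-(c * α))) :=
    fun α hα => Real.log_pos (hg1 α hα)
  have h1 : ∀ α ∈ Set.Ico (0:ℝ) 1, 0 < 1 - α := fun α hα => sub_pos.2 hα.2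
  have hg : ConcaveOn ℝ (Set.Ico (0:ℝ) 1) (fun α => 1 + A - B * (2:ℝ) ^ (-(c * α))) := by
    refine ⟨convex_Ico 0 1, ?_⟩
    intro x _ y _ a b ha hb hab
    have h := convexOn_exp.2 (Set.mem_univ (Real.log 2 * (-(c * x))))
      (Set.mem_univ (Real.log 2 * (-(c * y)))) ha hb hab
    have e : a • (Real.log 2 * (-(c * x))) + b • (Real.log 2 * (-(c * y)))
        = Real.log 2 * (-(c * (a • x + b • y))) := by
      simp only [smul_eq_mul]; ring
    rw [e] at h
    simp only [← Real.rpow_def_of_pos (zero_lt_two' ℝ)] at h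
    have h' := mul_le_mul_of_nonneg_left h hB.le
    simp only [smul_eq_mul] at h' ⊢
    have hb' : b = 1 - a := by linarith
    subst hb'
    linarith
  have hlin : ConcaveOn ℝ (Set.Ico (0:ℝ) 1) (fun α => 1 - α) := by
    refine ⟨convex_Ico 0 1, ?_⟩
    intro x _ y _ a b ha hb hab
    simp only [smul_eq_mul]
    linarith
  refine ⟨fun α hα => mul_pos (h1 α hα) (hl α hα), ?_⟩
  have hs := (log_concave_aux hlin h1).add
    (log_concave_aux (log_concave_aux hg fun α hα => zero_lt_one.trans (hg1 α hα)) hl)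
  refine hs.congr ?_
  intro α hα
  exact (Real.log_mul (h1 α hα).ne' (hl α hα).ne').symm
end

section
/- Let a ≥ 4, 0 < b ≤ a and c > 0 be reals, and define f(α) = (1+a)^{1+cα} − c·α·b for α ≥ 0. Then the function R(α) = (1−α)·ln( 1 + a − b·(1+a)/f(α) ) is concave on [0,1]. -/
theorem aux_log5 (a : ℝ) (ha : 4 ≤ a) : (8/5 : ℝ) ≤ Real.log (1 + a) := by
  rw [Real.le_log_iff_exp_le (by linarith)]
  have h1 : Real.exp (8/5) ^ 5 = Real.exp 1 ^ 8 := by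
    rw [← Real.exp_nat_mul, ← Real.exp_nat_mul]; norm_num
  have h2 : Real.exp 1 ^ 8 ≤ (2.7182818286 : ℝ) ^ 8 :=
    pow_le_pow_left₀ (Real.exp_pos _).le Real.exp_one_lt_d9.le 8
  have h3 : Real.exp (8/5) ^ 5 ≤ (5:ℝ) ^ 5 := by
    rw [h1]; refine h2.trans ?_; norm_num
  have := le_of_pow_le_pow_left₀ (by norm_num) (by norm_num) h3
  linarith

theorem aux_poly (L s : ℝ) (hL : 8/5 ≤ L) (h0 : 0 ≤ s) (h1 : s ≤ 1) :
    L ^ 2 * (1 - s) ≤ (L - s) ^ 2 * (2 - s) := by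
  have h2 : 0 ≤ (L - 8/5) * (L + 8/5 - 2 * (s * (2 - s))) := by
    apply mul_nonneg <;> nlinarith [sq_nonneg (s - 1)]
  have h3 : 0 ≤ (8/5)^2 - 2 * (8/5) * s * (2 - s) + s^2 * (2 - s) := by
    nlinarith [sq_nonneg (s - 4/5), mul_nonneg (sub_nonneg.2 h1) (sq_nonneg (s - 4/5))]
  nlinarith

theorem aux_key (u b t L : ℝ) (hL : 8/5 ≤ L) (hb : 0 < b) (ht : 0 ≤ t)
    (h : 0 < u - t * b - b) :
    u * L ^ 2 * ((u - t * b) * (u - t * b - b)) ≤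
      (u * L - b) ^ 2 * ((u - t * b) + (u - t * b - b)) := by
  have htb : 0 ≤ t * b := by positivity
  have hu : 0 < u := by linarith
  have hub : 0 < u - b := by linarith
  have hf : 0 < u - t * b := by linarith
  have hp := aux_poly L (b / u) hL (by positivity) (by rw [div_le_one hu]; linarith)
  have e1 : u * L ^ 2 ≤ (u * L - b) ^ 2 * (1 / u + 1 / (u - b)) := by
    have : (u * L - b) ^ 2 * (1 / u + 1 / (u - b)) - u * L ^ 2
        = u ^ 2 / (u - b) * ((L - b / u) ^ 2 * (2 - b / u) - L ^ 2 * (1 - b / u)) := by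
      field_simp
      ring
    have h2 : 0 ≤ u ^ 2 / (u - b) * ((L - b / u) ^ 2 * (2 - b / u) - L ^ 2 * (1 - b / u)) :=
      mul_nonneg (by positivity) (by linarith)
    linarith
  have e2 : 1 / u + 1 / (u - b) ≤ 1 / (u - t * b) + 1 / (u - t * b - b) := by
    apply add_le_add <;> apply one_div_le_one_div_of_le <;> linarith
  have e3 : u * L ^ 2 ≤ (u * L - b) ^ 2 * (1 / (u - t * b) + 1 / (u - t * b - b)) :=
    e1.trans (mul_le_mul_of_nonneg_left e2 (sq_nonneg _))
  calc _ ≤ (u * L - b) ^ 2 * (1 / (u - t * b) + 1 / (u - t * b - b))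
        * ((u - t * b) * (u - t * b - b)) :=
        mul_le_mul_of_nonneg_right e3 (by positivity)
    _ = _ := by
      generalize u - t * b - b = p at *
      generalize u - t * b = q at *
      field_simp
      ring

theorem aux_g (a b : ℝ) (ha : 4 ≤ a) (hb : 0 < b) (hba : b ≤ a) :
    ConcaveOn ℝ (Set.Ici (0:ℝ))
      (fun t => Real.log (1 + a - b * (1 + a) / ((1 + a) ^ (1 + t) - t * b))) ∧
    MonotoneOn 
      (fun t => Real.log (1 + a - b * (1 + a) / ((1 + a) ^ (1 + t) - t * b))) (Set.Ici (0:ℝ)) ∧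
    ∀ t : ℝ, 0 ≤ t → 0 ≤ Real.log (1 + a - b * (1 + a) / ((1 + a) ^ (1 + t) - t * b)) := by
  have hA : 0 < 1 + a := by linarith
  have hL := aux_log5 a ha
  set L := Real.log (1 + a) with hLdef
  have hbern : ∀ t : ℝ, 0 ≤ t → 1 + (1 + t) * a ≤ (1 + a) ^ (1 + t) := fun t ht =>
    one_add_mul_self_le_rpow_one_add (by linarith) (by linarith)
  have hfA : ∀ t : ℝ, 0 ≤ t → 1 + a ≤ (1 + a) ^ (1 + t) - t * b := fun t ht => by
    nlinarith [hbern t ht]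
  have hu : ∀ t : ℝ, HasDerivAt (fun t : ℝ => (1 + a) ^ (1 + t)) ((1 + a) ^ (1 + t) * L) t := by
    intro t
    have := ((hasDerivAt_id t).const_add 1).const_rpow hA
    rw [mul_one, mul_comm] at this
    exact this
  have hf : ∀ t : ℝ, HasDerivAt (fun t : ℝ => (1 + a) ^ (1 + t) - t * b)
      ((1 + a) ^ (1 + t) * L - b) t := by
    intro t
    have := (hu t).sub ((hasDerivAt_id t).mul_const b)
    rw [one_mul] at this
    exact this
  have hf' : ∀ t : ℝ, HasDerivAt (fun t : ℝ => (1 + a) ^ (1 + t) * L - b)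
      ((1 + a) ^ (1 + t) * L * L) t := by
    intro t
    exact ((hu t).mul_const L).sub_const b
  have hg : ∀ t : ℝ, 0 ≤ t → HasDerivAt
      (fun t => Real.log (1 + a - b * (1 + a) / ((1 + a) ^ (1 + t) - t * b)))
      (b * (((1 + a) ^ (1 + t) * L - b) /
        (((1 + a) ^ (1 + t) - t * b) * ((1 + a) ^ (1 + t) - t * b - b)))) t := by
    intro t ht
    have h1 := hfA t ht
    have hf0 : 0 < (1 + a) ^ (1 + t) - t * b := by linarith
    have hfb : 0 < (1 + a) ^ (1 + t) - t * b - b := by linarith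
    have hpos : 1 + a - b * (1 + a) / ((1 + a) ^ (1 + t) - t * b) ≠ 0 := by
      have : 1 + a - b * (1 + a) / ((1 + a) ^ (1 + t) - t * b)
        = (1 + a) * ((1 + a) ^ (1 + t) - t * b - b) / ((1 + a) ^ (1 + t) - t * b) := by
        generalize (1 + a) ^ (1 + t) - t * b = f at *
        field_simp
      rw [this]; positivity
    have h2 := (((hasDerivAt_const t (b * (1 + a))).div (hf t) hf0.ne').const_sub (1 + a)).log hpos
    refine HasDerivAt.congr_deriv h2 ?_
    have e : 1 + a - b * (1 + a) / ((1 + a) ^ (1 + t) - t * b)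
        = (1 + a) * ((1 + a) ^ (1 + t) - t * b - b) / ((1 + a) ^ (1 + t) - t * b) := by
        clear h2 hpos
        generalize (1 + a) ^ (1 + t) - t * b = f at *
        field_simp
    simp only [Pi.div_apply]
    rw [e]
    generalize (1 + a) ^ (1 + t) * L - b = w at *
    generalize (1 + a) ^ (1 + t) - t * b = f at *
    field_simp
    ring
  have hg' : ∀ t : ℝ, 0 ≤ t → HasDerivAt
      (fun t => b * (((1 + a) ^ (1 + t) * L - b) /
        (((1 + a) ^ (1 + t) - t * b) * ((1 + a) ^ (1 + t) - t * b - b))))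
      (b * (((1 + a) ^ (1 + t) * L * L *
        (((1 + a) ^ (1 + t) - t * b) * ((1 + a) ^ (1 + t) - t * b - b))
        - ((1 + a) ^ (1 + t) * L - b) *
        (((1 + a) ^ (1 + t) * L - b) * ((1 + a) ^ (1 + t) - t * b - b) +
         ((1 + a) ^ (1 + t) - t * b) * ((1 + a) ^ (1 + t) * L - b)))
         / (((1 + a) ^ (1 + t) - t * b) * ((1 + a) ^ (1 + t) - t * b - b)) ^ 2)) t := by
    intro t ht
    have h1 := hfA t ht
    have hf0 : 0 < (1 + a) ^ (1 + t) - t * b := by linarith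
    have hfb : 0 < (1 + a) ^ (1 + t) - t * b - b := by linarith
    exact ((hf' t).div ((hf t).mul ((hf t).sub_const b)) (mul_pos hf0 hfb).ne').const_mul b
  refine ⟨?_, ?_, ?_⟩
  · refine concaveOn_of_hasDerivWithinAt2_nonpos (convex_Ici 0)
      (fun t ht => (hg t ht).continuousAt.continuousWithinAt)
      (fun t ht => (hg t (interior_subset ht)).hasDerivWithinAt)
      (fun t ht => (hg' t (interior_subset ht)).hasDerivWithinAt) ?_
    intro t ht
    have ht : 0 ≤ t := interior_subset ht
    have h1 := hfA t ht
    have key := aux_key ((1 + a) ^ (1 + t)) b t L hL hb ht (by linarith)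
    apply mul_nonpos_of_nonneg_of_nonpos hb.le
    apply div_nonpos_of_nonpos_of_nonneg _ (sq_nonneg _)
    linarith
  · refine monotoneOn_of_hasDerivWithinAt_nonneg (convex_Ici 0)
      (fun t ht => (hg t ht).continuousAt.continuousWithinAt)
      (fun t ht => (hg t (interior_subset ht)).hasDerivWithinAt) ?_
    intro t ht
    have ht : 0 ≤ t := interior_subset ht
    have h1 := hfA t ht
    have htb : 0 ≤ t * b := by positivity
    apply mul_nonneg hb.le
    apply div_nonneg
    · nlinarith
    · apply mul_nonneg <;> linarith
  · intro t ht
    apply Real.log_nonneg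
    have h1 := hfA t ht
    have : b * (1 + a) / ((1 + a) ^ (1 + t) - t * b) ≤ b := by
      rw [div_le_iff₀ (by linarith)]
      exact mul_le_mul_of_nonneg_left h1 hb.le
    linarith

/-- Lemma 6: R(α) = (1−α)·ln(1 + a − b(1+a)/((1+a)^{1+cα} − cαb)) is concave on
[0,1] for a ≥ 4, 0 < b ≤ a, c > 0. -/
theorem stmt_16 (a b c : ℝ) (ha : 4 ≤ a) (hb : 0 < b) (hba : b ≤ a) (hc : 0 < c) :
    ConcaveOn ℝ (Set.Icc (0:ℝ) 1)
      (fun α => (1 - α) *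
        Real.log (1 + a - b * (1 + a) / ((1 + a) ^ (1 + c * α) - c * α * b))) := by
  obtain ⟨h1, h2, h3⟩ := aux_g a b ha hb hba
  have hcon := (h1.comp_linearMap (LinearMap.mulLeft ℝ c)).subset
    (s := Set.Icc (0:ℝ) 1) (fun x hx => mul_nonneg hc.le hx.1) (convex_Icc 0 1)
  have hlin : ConcaveOn ℝ (Set.Icc (0:ℝ) 1) (fun α : ℝ => 1 - α) :=
    (concaveOn_const 1 (convex_Icc 0 1)).sub (convexOn_id (convex_Icc 0 1))
  refine hlin.mul hcon (fun x hx => sub_nonneg.2 hx.2)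
    (fun x hx => h3 _ (mul_nonneg hc.le hx.1)) ?_
  intro x hx y hy hxy
  have hlt : x < y := by
    by_contra hn
    have hle : c * y ≤ c * x := mul_le_mul_of_nonneg_left (not_lt.1 hn) hc.le
    exact absurd (h2 (mul_nonneg hc.le hy.1) (mul_nonneg hc.le hx.1) hle) (not_le.2 hxy)
  show 1 - y ≤ 1 - x
  linarith
end

section
/- Let K ≥ 1 be an integer and let b ∈ ℝ^K have all entries positive. For each integer M ≥ 2 let σ(M) ∈ ℝ^K satisfy 0 ≤ σ_k(M) < (M−1)/M for all k, and suppose σ_k(M) → 0 as M → ∞ for each k. Define v(M) ∈ ℝ^K by v(M)_k = 1/((M−1) − M·σ_k(M)) and x(M) = diag(v(M))·b⁻² − ( v(M)ᵀb⁻² / (1 + Σ_k v(M)_k) )·v(M), where b⁻² is the entrywise vector (b_k⁻²). Then the normalized vectors (Σ_k x(M)_k)⁻¹·x(M) converge, as M → ∞, to (Σ_k b_k⁻²)⁻¹·b⁻². -/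
/-- Corollary 1: as M → ∞ with vanishing feedback quantization errors, the
normalized optimal energy allocation weight vector tends to ‖b⁻²‖₁⁻¹·b⁻². -/
theorem stmt_18 (K : ℕ) (hK : 1 ≤ K) (b : Fin K → ℝ) (hb : ∀ k, 0 < b k)
    (σ : ℕ → Fin K → ℝ)
    (hσ : ∀ M : ℕ, 2 ≤ M → ∀ k, 0 ≤ σ M k ∧ σ M k < ((M:ℝ) - 1) / M)
    (hσ0 : ∀ k, Filter.Tendsto (fun M => σ M k) Filter.atTop (nhds 0))
    (v : ℕ → Fin K → ℝ)
    (hv : ∀ M k, v M k = 1 / (((M:ℝ) - 1) - M * σ M k))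
    (x : ℕ → Fin K → ℝ)
    (hx : ∀ M k, x M k = v M k * ((b k) ^ 2)⁻¹ -
      (∑ i, v M i * ((b i) ^ 2)⁻¹) / (1 + ∑ i, v M i) * v M k) :
    Filter.Tendsto (fun M => (∑ k, x M k)⁻¹ • x M) Filter.atTop
      (nhds ((∑ k, ((b k) ^ 2)⁻¹)⁻¹ • fun k => ((b k) ^ 2)⁻¹)) := by
  have hinv : Filter.Tendsto (fun M : ℕ => ((M:ℝ))⁻¹) Filter.atTop (nhds 0) :=
    tendsto_inv_atTop_nhds_zero_nat
  have hMv : ∀ k, Filter.Tendsto (fun M : ℕ => (M:ℝ) * v M k) Filter.atTop (nhds 1) := by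
    intro k
    have h1 : Filter.Tendsto (fun M : ℕ => ((1 - ((M:ℝ))⁻¹) - σ M k)⁻¹)
        Filter.atTop (nhds ((1 - 0) - 0)⁻¹) :=
      ((tendsto_const_nhds.sub hinv).sub (hσ0 k)).inv₀ (by norm_num)
    have h2 : ((1 - 0) - 0 : ℝ)⁻¹ = 1 := by norm_num
    rw [h2] at h1
    refine h1.congr' ?_
    filter_upwards [Filter.eventually_ge_atTop 1] with M hM
    have hM0 : (M:ℝ) ≠ 0 := by positivity
    have h3 : ((M:ℝ) - 1) - M * σ M k = M * ((1 - ((M:ℝ))⁻¹) - σ M k) := by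
      field_simp
    rw [hv, h3, one_div, mul_inv, ← mul_assoc, mul_inv_cancel₀ hM0, one_mul]
  have hv0 : ∀ k, Filter.Tendsto (fun M : ℕ => v M k) Filter.atTop (nhds 0) := by
    intro k
    have h1 := hinv.mul (hMv k)
    rw [zero_mul] at h1
    refine h1.congr' ?_
    filter_upwards [Filter.eventually_ge_atTop 1] with M hM
    have hM0 : (M:ℝ) ≠ 0 := by positivity
    rw [← mul_assoc, inv_mul_cancel₀ hM0, one_mul]
  have hs1 : Filter.Tendsto (fun M : ℕ => ∑ i, v M i * ((b i) ^ 2)⁻¹)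
      Filter.atTop (nhds 0) := by
    have := tendsto_finsetSum (Finset.univ : Finset (Fin K))
      (fun i _ => (hv0 i).mul_const ((b i) ^ 2)⁻¹)
    simpa using this
  have hs2 : Filter.Tendsto (fun M : ℕ => 1 + ∑ i, v M i) Filter.atTop (nhds 1) := by
    have := (tendsto_finsetSum (Finset.univ : Finset (Fin K))
      (fun i _ => hv0 i)).const_add (1:ℝ)
    simpa using this
  have hy : ∀ k, Filter.Tendsto (fun M : ℕ => (M:ℝ) * x M k) Filter.atTop
      (nhds ((b k) ^ 2)⁻¹) := by
    intro k
    have h1 := ((hMv k).mul_const ((b k) ^ 2)⁻¹).sub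
      ((hs1.div hs2 one_ne_zero).mul (hMv k))
    have h2 : 1 * ((b k) ^ 2)⁻¹ - 0 / 1 * 1 = ((b k) ^ 2)⁻¹ := by ring
    rw [h2] at h1
    refine h1.congr fun M => ?_
    rw [hx]
    simp only [Pi.div_apply]
    ring
  have hsum := tendsto_finsetSum (Finset.univ : Finset (Fin K)) (fun i _ => hy i)
  have hpos : 0 < ∑ k, ((b k) ^ 2)⁻¹ := by
    refine Finset.sum_pos (fun i _ => ?_) ⟨⟨0, hK⟩, Finset.mem_univ _⟩
    have := hb i
    positivity
  rw [tendsto_pi_nhds]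
  intro k
  refine ((hsum.inv₀ hpos.ne').mul (hy k)).congr' ?_
  filter_upwards [Filter.eventually_ge_atTop 1] with M hM
  have hM0 : (M:ℝ) ≠ 0 := by positivity
  rw [← Finset.mul_sum, mul_inv, Pi.smul_apply, smul_eq_mul]
  field_simp
end

section
/- Let K ≥ 1 be an integer, δ > 0, and let d ∈ ℝ^K have all entries positive. For each integer M ≥ 2 let σ(M) ∈ ℝ^K satisfy 0 ≤ σ_k(M) < (M−1)/M for all k, with σ_k(M) → 0 as M → ∞ for each k; define v(M)_k = 1/((M−1) − M·σ_k(M)) and r_f(M) = ( v(M)ᵀd^{2δ} / (1 + Σ_k v(M)_k) )^{1/(2δ)}, where d^{2δ} denotes the entrywise vector (d_k^{2δ}). Then M^{1/(2δ)}·r_f(M) → (Σ_k d_k^{2δ})^{1/(2δ)} as M → ∞; in particular r_f(M) → 0, i.e., r_f(M) = O(M^{−1/(2δ)}). -/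
/-- Corollary 2: the fairness radius satisfies M^{1/(2δ)}·r_f(M) → ‖d‖_{2δ};
in particular r_f(M) → 0, i.e. r_f(M) = O(M^{−1/(2δ)}). -/
theorem stmt_19 (K : ℕ) (hK : 1 ≤ K) (δ : ℝ) (hδ : 0 < δ)
    (d : Fin K → ℝ) (hd : ∀ k, 0 < d k)
    (σ : ℕ → Fin K → ℝ)
    (hσ : ∀ M : ℕ, 2 ≤ M → ∀ k, 0 ≤ σ M k ∧ σ M k < ((M:ℝ) - 1) / M)
    (hσ0 : ∀ k, Filter.Tendsto (fun M => σ M k) Filter.atTop (nhds 0))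
    (v : ℕ → Fin K → ℝ)
    (hv : ∀ M k, v M k = 1 / (((M:ℝ) - 1) - M * σ M k))
    (rf : ℕ → ℝ)
    (hrf : ∀ M, rf M =
      ((∑ k, v M k * (d k) ^ (2 * δ)) / (1 + ∑ k, v M k)) ^ (1 / (2 * δ))) :
    Filter.Tendsto (fun M : ℕ => (M:ℝ) ^ (1 / (2 * δ)) * rf M) Filter.atTop
      (nhds ((∑ k, (d k) ^ (2 * δ)) ^ (1 / (2 * δ)))) ∧
    Filter.Tendsto rf Filter.atTop (nhds 0) := by
  have hp : 0 < 1 / (2 * δ) := by positivity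
  have hMv : ∀ k, Filter.Tendsto (fun M : ℕ => (M:ℝ) * v M k) Filter.atTop (nhds 1) := by
    intro k
    have h1 : Filter.Tendsto (fun M : ℕ => (1 - 1 / (M:ℝ) - σ M k)⁻¹) Filter.atTop
        (nhds ((1 - 0 - 0 : ℝ)⁻¹)) :=
      ((tendsto_const_nhds.sub tendsto_one_div_atTop_nhds_zero_nat).sub (hσ0 k)).inv₀
        (by norm_num)
    have h2 : ((1 - 0 - 0 : ℝ)⁻¹) = 1 := by norm_num
    rw [h2] at h1
    refine h1.congr' ?_
    filter_upwards [Filter.eventually_ge_atTop 2] with M hM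
    have hM0 : (M:ℝ) ≠ 0 := by positivity
    have e : ((M:ℝ) - 1) - M * σ M k = M * (1 - 1 / (M:ℝ) - σ M k) := by
      field_simp
    rw [hv, e, one_div (_ * _), mul_inv, ← mul_assoc, mul_inv_cancel₀ hM0, one_mul]
  have hv0 : ∀ k, Filter.Tendsto (fun M : ℕ => v M k) Filter.atTop (nhds 0) := by
    intro k
    have h1 := (tendsto_one_div_atTop_nhds_zero_nat (𝕜 := ℝ)).mul (hMv k)
    rw [zero_mul] at h1
    refine h1.congr' ?_
    filter_upwards [Filter.eventually_ge_atTop 2] with M hM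
    have hM0 : (M:ℝ) ≠ 0 := by positivity
    field_simp
  have hvpos : ∀ M : ℕ, 2 ≤ M → ∀ k, 0 ≤ v M k := by
    intro M hM k
    have hM0 : (0:ℝ) < M := by positivity
    have h := (hσ M hM k).2
    rw [lt_div_iff₀ hM0] at h
    rw [hv]
    apply one_div_nonneg.mpr
    linarith
  have hden : Filter.Tendsto (fun M : ℕ => 1 + ∑ k, v M k) Filter.atTop (nhds 1) := by
    have h := (tendsto_finsetSum Finset.univ (fun k _ => hv0 k)).const_add (1:ℝ)
    simpa using h
  have hB0 : Filter.Tendsto (fun M : ℕ => (∑ k, v M k * (d k) ^ (2 * δ)) / (1 + ∑ k, v M k))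
      Filter.atTop (nhds 0) := by
    have h := (tendsto_finsetSum Finset.univ
      (fun k _ => (hv0 k).mul_const ((d k) ^ (2 * δ)))).div hden one_ne_zero
    simp only [zero_mul, Finset.sum_const_zero, zero_div] at h
    exact h
  have hMB : Filter.Tendsto
      (fun M : ℕ => (M:ℝ) * ((∑ k, v M k * (d k) ^ (2 * δ)) / (1 + ∑ k, v M k)))
      Filter.atTop (nhds (∑ k, (d k) ^ (2 * δ))) := by
    have h := (tendsto_finsetSum Finset.univ
      (fun k _ => (hMv k).mul_const ((d k) ^ (2 * δ)))).div hden one_ne_zero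
    simp only [one_mul, div_one] at h
    refine h.congr ?_
    intro M
    simp only [Pi.div_apply, mul_assoc, ← Finset.mul_sum, mul_div_assoc]
  constructor
  · refine (hMB.rpow_const (Or.inr hp.le)).congr' ?_
    filter_upwards [Filter.eventually_ge_atTop 2] with M hM
    rw [hrf, Real.mul_rpow (Nat.cast_nonneg M)]
    apply div_nonneg
    · exact Finset.sum_nonneg fun k _ =>
        mul_nonneg (hvpos M hM k) (Real.rpow_nonneg (hd k).le _)
    · exact add_nonneg zero_le_one (Finset.sum_nonneg fun k _ => hvpos M hM k)
  · have h := hB0.rpow_const (p := 1 / (2 * δ)) (Or.inr hp.le)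
    rw [Real.zero_rpow hp.ne'] at h
    exact h.congr fun M => (hrf M).symm
end
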